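/- Let A ⊆ B be a (φ,ψ)-bounded extension of the multi-filtered K-algebra A. Let (α₁,α₂), (β₁,β₂) ∈ ℕ^m × ℕ^s and set α = wt(α₁,α₂), β = wt(β₁,β₂). Suppose r = r' x^{α₂} + u and s = s' x^{β₂} + v, where r' ∈ F_{α₁}(A), s' ∈ F_{β₁}(A), u ∈ Σ_{(μ₂, wt(μ)) ≺' (α₂, α)} F_{μ₁}(A)x^{μ₂} and v ∈ Σ_{(ν₂, wt(ν)) ≺' (β₂, β)} F_{ν₁}(A)x^{ν₂}. Then there exists t ∈ F_{α₁+β₁}(A) such that rs − t·x^{α₂+β₂} ∈ Σ_{(ω₂, wt(ω)) ≺' (α₂+β₂, α+β)} F_{ω₁}(A)x^{ω₂}. -/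

import Mathlib

open scoped BigOperators

/-- Multi-indices: elements of `ℕ^n`. -/
abbrev MIdx (n : ℕ) := Fin n → ℕ

/-- An admissible order on `ℕ^n`: a total order compatible with addition and having `0` as
least element. -/
structure AdmOrder (n : ℕ) where
  le : MIdx n → MIdx n → Prop
  le_refl : ∀ a, le a a
  le_trans : ∀ {a b c}, le a b → le b c → le a c
  le_antisymm : ∀ {a b}, le a b → le b a → a = b
  le_total : ∀ a b, le a b ∨ le b a
  add_right : ∀ {a b : MIdx n} (c : MIdx n), le a b → le (a + c) (b + c)
  zero_le : ∀ a, le 0 a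

/-- The strict order associated to an admissible order. -/
def AdmOrder.lt {n : ℕ} (o : AdmOrder n) (a b : MIdx n) : Prop :=
  o.le a b ∧ a ≠ b

/-- The ordered standard monomial `x^β = x₁^{β₁} ⋯ x_s^{β_s}`. -/
def smon {B : Type*} [Monoid B] {s : ℕ} (x : Fin s → B) (β : MIdx s) : B :=
  (List.ofFn fun i => x i ^ β i).prod

/-- The `K`-submodule `Σ_{γ with P γ} F_{γ₁}(A)·x^{γ₂}` of `B`. -/
def monSum (K : Type*) [CommRing K] (B : Type*) [Ring B] [Algebra K B]
    {m s : ℕ} (F : MIdx m → Submodule K B) (x : Fin s → B)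
    (P : MIdx m × MIdx s → Prop) : Submodule K B :=
  ⨆ γ ∈ {γ : MIdx m × MIdx s | P γ},
    (F γ.1).map (LinearMap.mulRight K (smon x γ.2))

/-- A `(φ,ψ)`-bounded extension `A ⊆ B` of a multi-filtered `K`-algebra `A`, where `A` is
realized as a subalgebra of `B` carrying an `(ℕ^m,⪯₁)`-filtration `F`, and `B` is generated
over `A` by elements `x 1, …, x s`, subject to the axioms (EA1)–(EA4). -/
structure BoundedExt (K : Type*) [CommRing K] (B : Type*) [Ring B] [Algebra K B]
    (m s n : ℕ) where
  /-- admissible order `⪯₁` on `ℕ^m` -/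
  o1 : AdmOrder m
  /-- admissible order `⪯₂` on `ℕ^s` -/
  o2 : AdmOrder s
  /-- admissible order `⪯` on `ℕ^n` -/
  o : AdmOrder n
  /-- the monoid morphism `φ : ℕ^m → ℕ^n` -/
  φ : MIdx m →+ MIdx n
  /-- the monoid morphism `ψ : ℕ^s → ℕ^n` -/
  ψ : MIdx s →+ MIdx n
  φ_mono : ∀ {a b : MIdx m}, o1.le a b → o.le (φ a) (φ b)
  ψ_mono : ∀ {a b : MIdx s}, o2.le a b → o.le (ψ a) (ψ b)
  /-- the subalgebra `A` of `B` -/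
  A : Subalgebra K B
  /-- (EA1): the `(ℕ^m,⪯₁)`-filtration on `A` -/
  F : MIdx m → Submodule K B
  F_le_A : ∀ a : MIdx m, F a ≤ Subalgebra.toSubmodule A
  F_mono : ∀ {a b : MIdx m}, o1.le a b → F a ≤ F b
  F_mul : ∀ {a b : MIdx m} {u v : B}, u ∈ F a → v ∈ F b → u * v ∈ F (a + b)
  F_exhaustive : ∀ u ∈ A, ∃ a : MIdx m, u ∈ F a
  F_one : (1 : B) ∈ F 0
  /-- the generators `x_1, …, x_s` -/
  x : Fin s → B
  /-- (EA2): `B` is generated as a `K`-algebra by `A` and `x_1, …, x_s` -/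
  gen : Algebra.adjoin K ((A : Set B) ∪ Set.range x) = ⊤
  /-- (EA3) -/
  EA3 : ∀ (i : Fin s) (α : MIdx m), ∀ a ∈ F α,
    x i * a ∈ (F α).map (LinearMap.mulRight K (x i)) ⊔
      monSum K B F x (fun γ => o.lt (φ γ.1 + ψ γ.2) (φ α + ψ (Pi.single i 1)))
  /-- (EA4) -/
  EA4 : ∀ i j : Fin s, i < j → ∃ q ∈ F 0,
    x j * x i - q * (x i * x j) ∈
      monSum K B F x (fun γ => o.lt (φ γ.1 + ψ γ.2) (ψ (Pi.single i 1 + Pi.single j 1)))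

namespace BoundedExt

variable {K : Type*} [CommRing K] {B : Type*} [Ring B] [Algebra K B] {m s n : ℕ}

/-- The weight `wt(γ) = φ(γ₁) + ψ(γ₂)` of a pair of multi-indices. -/
def wt (E : BoundedExt K B m s n) (γ : MIdx m × MIdx s) : MIdx n :=
  E.φ γ.1 + E.ψ γ.2

/-- The filtration `F̃_α(B) = Σ_{wt(γ) ⪯ α} F_{γ₁}(A)x^{γ₂}` on `B`. -/
def tF (E : BoundedExt K B m s n) (α : MIdx n) : Submodule K B :=
  monSum K B E.F E.x (fun γ => E.o.le (E.wt γ) α)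

/-- `F̃_{≺α}(B) = ⋃_{β ≺ α} F̃_β(B)`. -/
def tFlt (E : BoundedExt K B m s n) (α : MIdx n) : Submodule K B :=
  ⨆ β ∈ {β : MIdx n | E.o.lt β α}, E.tF β

/-- `F_{≺α}(A) = ⋃_{β ≺₁ α} F_β(A)`. -/
def Flt (E : BoundedExt K B m s n) (α : MIdx m) : Submodule K B :=
  ⨆ β ∈ {β : MIdx m | E.o1.lt β α}, E.F β

/-- The strict order `≺'` on `ℕ^s × ℕ^n`: `(λ,ν) ≺' (λ',ν')` iff `ν ≺ ν'`, or `ν = ν'`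
and `λ ≺₂ λ'`. -/
def ltP (E : BoundedExt K B m s n) (p q : MIdx s × MIdx n) : Prop :=
  E.o.lt p.2 q.2 ∨ (p.2 = q.2 ∧ E.o2.lt p.1 q.1)

end BoundedExt

namespace AdmOrder

variable {n : ℕ} (o : AdmOrder n) {a b c d : MIdx n}

theorem add_left (c : MIdx n) (h : o.le a b) : o.le (c + a) (c + b) := by
  simpa only [add_comm c] using o.add_right c h

theorem add_le_add (h : o.le a b) (h' : o.le c d) : o.le (a + c) (b + d) :=
  o.le_trans (o.add_right c h) (o.add_left b h')

theorem lt_of_le_of_lt (h : o.le a b) (h' : o.lt b c) : o.lt a c :=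
  ⟨o.le_trans h h'.1, fun e => h'.2 (o.le_antisymm h'.1 (e ▸ h))⟩

theorem lt_of_lt_of_le (h : o.lt a b) (h' : o.le b c) : o.lt a c :=
  ⟨o.le_trans h.1 h', fun e => h.2 (o.le_antisymm h.1 (e ▸ h'))⟩

theorem lt_add_right (c : MIdx n) (h : o.lt a b) : o.lt (a + c) (b + c) :=
  ⟨o.add_right c h.1, fun e => h.2 (add_right_cancel e)⟩

theorem lt_add_left (c : MIdx n) (h : o.lt a b) : o.lt (c + a) (c + b) := by
  simpa only [add_comm c] using o.lt_add_right c h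

theorem add_lt_add_of_lt_of_le (h : o.lt a b) (h' : o.le c d) : o.lt (a + c) (b + d) :=
  o.lt_of_lt_of_le (o.lt_add_right c h) (o.add_left b h')

theorem add_lt_add_of_le_of_lt (h : o.le a b) (h' : o.lt c d) : o.lt (a + c) (b + d) :=
  o.lt_of_le_of_lt (o.add_right c h) (o.lt_add_left b h')

theorem le_of_le (h : a ≤ b) : o.le a b := by
  have := o.add_right a (o.zero_le (b - a))
  rwa [zero_add, tsub_add_cancel_of_le h] at this

/-- An admissible order is a well-order, by Dickson's lemma. -/
theorem lt_wellFounded : WellFounded o.lt := by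
  refine wellFounded_iff_isEmpty_descending_chain.mpr ⟨fun ⟨f, hf⟩ => ?_⟩
  have hlt : ∀ i k, o.lt (f (i + k + 1)) (f i) := by
    intro i k
    induction k with
    | zero => exact hf i
    | succ k ih => exact o.lt_of_lt_of_le (hf _) ih.1
  obtain ⟨i, j, hij, h⟩ := wellQuasiOrdered_le f
  obtain ⟨k, rfl⟩ := Nat.exists_eq_add_of_lt hij
  exact (o.lt_of_le_of_lt (o.le_of_le h) (hlt i k)).2 rfl

end AdmOrder

section SortedWord

variable {s : ℕ}

/-- The nondecreasing word in `Fin s` in which each letter `i` occurs `β i` times. -/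
def sortedWord (β : MIdx s) : List (Fin s) :=
  (List.ofFn fun i => List.replicate (β i) i).flatten

theorem count_sortedWord (β : MIdx s) (i : Fin s) : (sortedWord β).count i = β i := by
  simp [sortedWord, List.count_flatten, List.map_ofFn, List.sum_ofFn, List.count_replicate]

theorem pairwise_sortedWord (β : MIdx s) : (sortedWord β).Pairwise (· ≤ ·) := by
  rw [sortedWord, List.pairwise_flatten]
  refine ⟨?_, ?_⟩
  · simp [List.mem_ofFn, List.pairwise_replicate]
  · rw [List.pairwise_ofFn]
    intro i j hij a ha b hb
    rw [List.eq_of_mem_replicate ha, List.eq_of_mem_replicate hb]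
    exact hij.le

theorem sortedWord_single (i : Fin s) : sortedWord (Pi.single i 1) = [i] := by
  rw [← List.perm_singleton, List.perm_iff_count]
  intro j
  rw [count_sortedWord, List.count_singleton]
  simp [Pi.single_apply, eq_comm (a := j)]

theorem sortedWord_append_perm (α β : MIdx s) :
    (sortedWord α ++ sortedWord β).Perm (sortedWord (α + β)) := by
  simp [List.perm_iff_count, count_sortedWord]

theorem insertionSort_sortedWord_append (α β : MIdx s) :
    (sortedWord α ++ sortedWord β).insertionSort (· ≤ ·) = sortedWord (α + β) :=
  ((List.perm_insertionSort _ _).trans (sortedWord_append_perm α β)).eq_of_pairwise'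
    (List.pairwise_insertionSort _ _) (pairwise_sortedWord _)

theorem prod_map_sortedWord {M : Type*} [Monoid M] (x : Fin s → M) (β : MIdx s) :
    ((sortedWord β).map x).prod = smon x β := by
  simp only [sortedWord, smon, List.map_flatten, List.prod_flatten, List.map_ofFn,
    Function.comp_def, List.map_replicate, List.prod_replicate]

theorem smon_single {M : Type*} [Monoid M] (x : Fin s → M) (i : Fin s) :
    smon x (Pi.single i 1) = x i := by
  simp [← prod_map_sortedWord, sortedWord_single]

end SortedWord

section MonSum

variable {K : Type*} [CommRing K] {B : Type*} [Ring B] [Algebra K B] {m s : ℕ}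
  {F : MIdx m → Submodule K B} {x : Fin s → B} {P Q : MIdx m × MIdx s → Prop}

theorem mul_smon_mem_monSum {γ : MIdx m × MIdx s} (hγ : P γ) {a : B} (ha : a ∈ F γ.1) :
    a * smon x γ.2 ∈ monSum K B F x P :=
  Submodule.mem_iSup_of_mem γ (Submodule.mem_iSup_of_mem hγ ⟨a, ha, rfl⟩)

theorem monSum_le {N : Submodule K B}
    (h : ∀ γ, P γ → ∀ a ∈ F γ.1, a * smon x γ.2 ∈ N) : monSum K B F x P ≤ N := by
  refine iSup₂_le fun γ hγ => ?_
  rintro _ ⟨a, ha, rfl⟩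
  exact h γ hγ a ha

theorem monSum_mono (h : ∀ γ, P γ → Q γ) : monSum K B F x P ≤ monSum K B F x Q :=
  monSum_le fun γ hγ _ ha => mul_smon_mem_monSum (h γ hγ) ha

theorem mul_mem_of_mem_monSum {N : Submodule K B}
    (h : ∀ γ, P γ → ∀ a ∈ F γ.1, ∀ γ', Q γ' → ∀ b ∈ F γ'.1,
      a * smon x γ.2 * (b * smon x γ'.2) ∈ N) {p q : B}
    (hp : p ∈ monSum K B F x P) (hq : q ∈ monSum K B F x Q) : p * q ∈ N := by
  have hP : monSum K B F x P ≤ N.comap (LinearMap.mulRight K q) := by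
    refine monSum_le fun γ hγ a ha => ?_
    have hQ : monSum K B F x Q ≤ N.comap (LinearMap.mulLeft K (a * smon x γ.2)) :=
      monSum_le fun γ' hγ' b hb => h γ hγ a ha γ' hγ' b hb
    exact hQ hq
  exact hP hp

end MonSum

namespace BoundedExt

variable {K : Type*} [CommRing K] {B : Type*} [Ring B] [Algebra K B] {m s n : ℕ}
  (E : BoundedExt K B m s n)

/-- The sum of all `F_{γ₁}(A)x^{γ₂}` with `wt γ ≺ α`. -/
def lowerSum (α : MIdx n) : Submodule K B :=
  monSum K B E.F E.x fun γ => E.o.lt (E.wt γ) α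

/-- The product of the generators along a word. -/
def wordProd (l : List (Fin s)) : B := (l.map E.x).prod

/-- The weight of a word, i.e. the value of `ψ` at its exponent vector. -/
def wordWt (l : List (Fin s)) : MIdx n := (l.map fun i => E.ψ (Pi.single i 1)).sum

/-- The filtration `F̃` is multiplicative in degrees smaller than `δ`. -/
def MulBelow (δ : MIdx n) : Prop :=
  ∀ a b, E.o.lt (a + b) δ → ∀ p ∈ E.tF a, ∀ q ∈ E.tF b, p * q ∈ E.tF (a + b)

variable {E} {δ : MIdx n}

theorem wt_add (γ γ' : MIdx m × MIdx s) : E.wt (γ + γ') = E.wt γ + E.wt γ' := by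
  simp only [wt, Prod.fst_add, Prod.snd_add, map_add]
  abel

@[simp] theorem wordProd_nil : E.wordProd [] = 1 := rfl

@[simp] theorem wordProd_cons (i : Fin s) (l : List (Fin s)) :
    E.wordProd (i :: l) = E.x i * E.wordProd l := by simp [wordProd]

theorem wordProd_append (l l' : List (Fin s)) :
    E.wordProd (l ++ l') = E.wordProd l * E.wordProd l' := by simp [wordProd]

theorem wordProd_sortedWord (β : MIdx s) : E.wordProd (sortedWord β) = smon E.x β :=
  prod_map_sortedWord _ _

@[simp] theorem wordWt_nil : E.wordWt [] = 0 := rfl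

@[simp] theorem wordWt_cons (i : Fin s) (l : List (Fin s)) :
    E.wordWt (i :: l) = E.ψ (Pi.single i 1) + E.wordWt l := by simp [wordWt]

theorem wordWt_append (l l' : List (Fin s)) :
    E.wordWt (l ++ l') = E.wordWt l + E.wordWt l' := by simp [wordWt]

theorem wordWt_perm {l l' : List (Fin s)} (h : l.Perm l') : E.wordWt l = E.wordWt l' :=
  (h.map _).sum_eq

theorem wordWt_sortedWord (β : MIdx s) : E.wordWt (sortedWord β) = E.ψ β := by
  have hβ : β = ∑ i, β i • (Pi.single i 1 : MIdx s) := by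
    ext j
    simp [Finset.sum_apply, Pi.single_apply]
  conv_rhs => rw [hβ]
  simp only [wordWt, sortedWord, List.map_flatten, List.sum_flatten, List.map_ofFn,
    List.sum_ofFn, Function.comp_def, List.map_replicate, List.sum_replicate, map_sum, map_nsmul]

theorem le_of_add_le_right {a b c : MIdx n} (h : E.o.le (a + b) c) : E.o.le b c :=
  E.o.le_trans (by simpa using E.o.add_right b (E.o.zero_le a)) h

theorem x_mem_tF (i : Fin s) : E.x i ∈ E.tF (E.ψ (Pi.single i 1)) := by
  have h : (1 : B) * smon E.x (Pi.single i 1) ∈ E.tF (E.ψ (Pi.single i 1)) :=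
    mul_smon_mem_monSum (γ := (0, Pi.single i 1)) (by simp [wt, E.o.le_refl]) E.F_one
  simpa [smon_single] using h

theorem tF_mono {a b : MIdx n} (h : E.o.le a b) : E.tF a ≤ E.tF b :=
  monSum_mono fun _ hγ => E.o.le_trans hγ h

theorem lowerSum_mono {a b : MIdx n} (h : E.o.le a b) : E.lowerSum a ≤ E.lowerSum b :=
  monSum_mono fun _ hγ => E.o.lt_of_lt_of_le hγ h

theorem lowerSum_le_tF (a : MIdx n) : E.lowerSum a ≤ E.tF a :=
  monSum_mono fun _ hγ => hγ.1

theorem tF_le_lowerSum {a b : MIdx n} (h : E.o.lt a b) : E.tF a ≤ E.lowerSum b :=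
  monSum_mono fun _ hγ => E.o.lt_of_le_of_lt hγ h

theorem F_mul_lowerSum {α : MIdx m} {a : B} (ha : a ∈ E.F α) {b : MIdx n} {p : B}
    (hp : p ∈ E.lowerSum b) : a * p ∈ E.lowerSum (E.φ α + b) := by
  have h : E.lowerSum b ≤ (E.lowerSum (E.φ α + b)).comap (LinearMap.mulLeft K a) := by
    refine monSum_le fun γ hγ c hc => ?_
    change a * (c * smon E.x γ.2) ∈ E.lowerSum (E.φ α + b)
    rw [← mul_assoc]
    refine mul_smon_mem_monSum (γ := (α + γ.1, γ.2)) ?_ (E.F_mul ha hc)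
    simpa [wt, add_assoc] using E.o.lt_add_left (E.φ α) hγ
  exact h hp

theorem F_zero_mul_lowerSum {a : B} (ha : a ∈ E.F 0) {b : MIdx n} {p : B}
    (hp : p ∈ E.lowerSum b) : a * p ∈ E.lowerSum b := by
  simpa using F_mul_lowerSum ha hp

theorem exists_x_mul_sub_mem (i : Fin s) {α : MIdx m} {a : B} (ha : a ∈ E.F α) :
    ∃ a' ∈ E.F α, E.x i * a - a' * E.x i ∈ E.lowerSum (E.φ α + E.ψ (Pi.single i 1)) := by
  obtain ⟨_, ⟨a', ha', rfl⟩, p, hp, h⟩ := Submodule.mem_sup.mp (E.EA3 i α a ha)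
  refine ⟨a', ha', ?_⟩
  rw [← h]
  change a' * E.x i + p - a' * E.x i ∈ _
  rwa [add_sub_cancel_left]

namespace MulBelow

theorem lowerSum_mul (H : E.MulBelow δ) {a b : MIdx n} (hab : E.o.le (a + b) δ) {p q : B}
    (hp : p ∈ E.lowerSum a) (hq : q ∈ E.tF b) : p * q ∈ E.lowerSum (a + b) := by
  have h : E.lowerSum a ≤ (E.lowerSum (a + b)).comap (LinearMap.mulRight K q) := by
    refine monSum_le fun γ hγ c hc => ?_
    have hlt := E.o.lt_add_right b hγ
    exact tF_le_lowerSum hlt (H _ _ (E.o.lt_of_lt_of_le hlt hab) _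
      (mul_smon_mem_monSum (E.o.le_refl _) hc) _ hq)
  exact h hp

theorem mul_lowerSum (H : E.MulBelow δ) {a b : MIdx n} (hab : E.o.le (a + b) δ) {p q : B}
    (hp : p ∈ E.tF a) (hq : q ∈ E.lowerSum b) : p * q ∈ E.lowerSum (a + b) := by
  have h : E.lowerSum b ≤ (E.lowerSum (a + b)).comap (LinearMap.mulLeft K p) := by
    refine monSum_le fun γ hγ c hc => ?_
    have hlt := E.o.lt_add_left a hγ
    exact tF_le_lowerSum hlt (H _ _ (E.o.lt_of_lt_of_le hlt hab) _ hp _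
      (mul_smon_mem_monSum (E.o.le_refl _) hc))
  exact h hq

theorem lowerSum_mul_wordProd (H : E.MulBelow δ) (l : List (Fin s)) {a : MIdx n} {p : B}
    (hp : p ∈ E.lowerSum a) (ha : E.o.le (a + E.wordWt l) δ) :
    p * E.wordProd l ∈ E.lowerSum (a + E.wordWt l) := by
  induction l generalizing a p with
  | nil => simpa using hp
  | cons i l ih =>
    rw [wordWt_cons, ← add_assoc] at ha ⊢
    rw [wordProd_cons, ← mul_assoc]
    refine ih (H.lowerSum_mul ?_ hp (x_mem_tF i)) ha
    exact E.o.le_trans (E.o.le_of_le le_self_add) ha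

theorem exists_wordProd_mul_sub_mem (H : E.MulBelow δ) (l : List (Fin s)) {α : MIdx m} {a : B}
    (ha : a ∈ E.F α) (hl : E.o.le (E.φ α + E.wordWt l) δ) :
    ∃ a' ∈ E.F α,
      E.wordProd l * a - a' * E.wordProd l ∈ E.lowerSum (E.φ α + E.wordWt l) := by
  induction l with
  | nil => exact ⟨a, ha, by simp⟩
  | cons i l ih =>
    rw [wordWt_cons] at hl ⊢
    rw [add_left_comm] at hl
    obtain ⟨b, hb, hab⟩ := ih (le_of_add_le_right hl)
    obtain ⟨c, hc, hbc⟩ := exists_x_mul_sub_mem i hb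
    refine ⟨c, hc, ?_⟩
    have h₁ := H.mul_lowerSum hl (x_mem_tF i) hab
    rw [add_left_comm] at hl h₁
    have h₂ := H.lowerSum_mul_wordProd l hbc (by rwa [add_assoc])
    rw [add_assoc] at h₂
    convert add_mem h₁ h₂ using 1
    rw [wordProd_cons]
    noncomm_ring

theorem exists_wordProd_orderedInsert (H : E.MulBelow δ) (i : Fin s) (l : List (Fin s))
    (hl : E.o.le (E.wordWt (i :: l)) δ) :
    ∃ q ∈ E.F 0, E.wordProd (i :: l) - q * E.wordProd (l.orderedInsert (· ≤ ·) i) ∈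
      E.lowerSum (E.wordWt (i :: l)) := by
  induction l with
  | nil => exact ⟨1, E.F_one, by simp⟩
  | cons j l ih =>
    by_cases hij : i ≤ j
    · exact ⟨1, E.F_one, by simp [List.orderedInsert_cons, hij]⟩
    have hperm : (i :: j :: l).Perm (j :: i :: l) := List.Perm.swap _ _ _
    rw [wordWt_perm hperm] at hl ⊢
    have hl' := hl
    rw [wordWt_cons] at hl' ⊢
    obtain ⟨q, hq, hqx⟩ := E.EA4 j i (not_le.mp hij)
    obtain ⟨q₁, hq₁, hq₁x⟩ := ih (le_of_add_le_right hl')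
    obtain ⟨q₂, hq₂, hq₂x⟩ := exists_x_mul_sub_mem (E := E) j hq₁
    refine ⟨q * q₂, by simpa using E.F_mul hq hq₂, ?_⟩
    have h₁ := F_zero_mul_lowerSum hq (H.mul_lowerSum hl' (x_mem_tF j) hq₁x)
    have hins : E.wordWt (l.orderedInsert (· ≤ ·) i) = E.wordWt (i :: l) :=
      wordWt_perm (List.perm_orderedInsert _ _ _)
    rw [map_zero, zero_add] at hq₂x
    rw [← hins] at hl'
    have h₂ := F_zero_mul_lowerSum hq (H.lowerSum_mul_wordProd _ hq₂x hl')
    rw [hins] at h₂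
    have hw : E.ψ (Pi.single j 1) + E.wordWt (i :: l) =
        E.ψ (Pi.single j 1 + Pi.single i 1) + E.wordWt l := by
      rw [wordWt_cons, map_add, add_assoc]
    have h₃ := H.lowerSum_mul_wordProd l hqx (by rwa [← hw, ← wordWt_cons])
    rw [← hw] at h₃
    convert add_mem (add_mem h₁ h₂) h₃ using 1
    simp only [List.orderedInsert_cons, hij, if_false, wordProd_cons]
    noncomm_ring

theorem exists_wordProd_insertionSort (H : E.MulBelow δ) (l : List (Fin s))
    (hl : E.o.le (E.wordWt l) δ) :
    ∃ q ∈ E.F 0, E.wordProd l - q * E.wordProd (l.insertionSort (· ≤ ·)) ∈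
      E.lowerSum (E.wordWt l) := by
  induction l with
  | nil => exact ⟨1, E.F_one, by simp⟩
  | cons i l ih =>
    have hsort : E.wordWt (i :: l.insertionSort (· ≤ ·)) = E.wordWt (i :: l) :=
      wordWt_perm ((List.perm_insertionSort _ _).cons i)
    have hl' := hl
    rw [wordWt_cons] at hl'
    obtain ⟨q, hq, hqx⟩ := ih (le_of_add_le_right hl')
    obtain ⟨q₁, hq₁, hq₁x⟩ := exists_x_mul_sub_mem (E := E) i hq
    obtain ⟨q₂, hq₂, hq₂x⟩ :=
      H.exists_wordProd_orderedInsert i (l.insertionSort (· ≤ ·)) (by rwa [hsort])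
    refine ⟨q₁ * q₂, by simpa using E.F_mul hq₁ hq₂, ?_⟩
    have h₁ := H.mul_lowerSum hl' (x_mem_tF i) hqx
    have h₂ := F_zero_mul_lowerSum hq₁ hq₂x
    rw [map_zero, zero_add] at hq₁x
    have h₃ := H.lowerSum_mul_wordProd (l.insertionSort (· ≤ ·)) hq₁x
      (by rwa [← wordWt_cons, hsort])
    rw [← wordWt_cons, hsort] at h₃
    rw [hsort] at h₂
    rw [← wordWt_cons] at h₁
    convert add_mem (add_mem h₁ h₂) h₃ using 1
    simp only [List.insertionSort_cons, wordProd_cons]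
    noncomm_ring

theorem exists_smon_mul_smon (H : E.MulBelow δ) (α β : MIdx s)
    (h : E.o.le (E.ψ (α + β)) δ) :
    ∃ q ∈ E.F 0, smon E.x α * smon E.x β - q * smon E.x (α + β) ∈
      E.lowerSum (E.ψ (α + β)) := by
  have hw : E.wordWt (sortedWord α ++ sortedWord β) = E.ψ (α + β) := by
    simp [wordWt_append, wordWt_sortedWord]
  have := H.exists_wordProd_insertionSort (sortedWord α ++ sortedWord β) (by rwa [hw])
  simpa only [hw, insertionSort_sortedWord_append, wordProd_append, wordProd_sortedWord] using this

theorem exists_mul_smon_mul_smon (H : E.MulBelow δ) {γ γ' : MIdx m × MIdx s}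
    (h : E.o.le (E.wt γ + E.wt γ') δ) {a b : B} (ha : a ∈ E.F γ.1) (hb : b ∈ E.F γ'.1) :
    ∃ t ∈ E.F (γ.1 + γ'.1),
      a * smon E.x γ.2 * (b * smon E.x γ'.2) - t * smon E.x (γ.2 + γ'.2) ∈
        E.lowerSum (E.wt γ + E.wt γ') := by
  have hw : E.wt γ + E.wt γ' =
      E.φ γ.1 + (E.φ γ'.1 + E.wordWt (sortedWord γ.2) + E.wordWt (sortedWord γ'.2)) := by
    simp only [wt, wordWt_sortedWord]
    abel
  have hw' : E.wt γ + E.wt γ' = E.φ (γ.1 + γ'.1) + E.ψ (γ.2 + γ'.2) := (wt_add γ γ').symm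
  have hle := h
  rw [hw] at hle
  replace hle := le_of_add_le_right hle
  obtain ⟨c, hc, hbc⟩ := H.exists_wordProd_mul_sub_mem (sortedWord γ.2) hb
    (E.o.le_trans (E.o.le_of_le le_self_add) hle)
  obtain ⟨q, hq, hqx⟩ := H.exists_smon_mul_smon γ.2 γ'.2
    (le_of_add_le_right (by rwa [hw'] at h))
  have h₁ := F_mul_lowerSum ha (H.lowerSum_mul_wordProd (sortedWord γ'.2) hbc hle)
  have h₂ := F_mul_lowerSum (E.F_mul ha hc) hqx
  refine ⟨a * c * q, by simpa using E.F_mul (E.F_mul ha hc) hq, ?_⟩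
  rw [← hw] at h₁
  rw [← hw'] at h₂
  convert add_mem h₁ h₂ using 1
  simp only [wordProd_sortedWord]
  noncomm_ring

end MulBelow

theorem mulBelow (δ : MIdx n) : E.MulBelow δ := by
  induction δ using E.o.lt_wellFounded.induction with
  | _ δ ih =>
    intro a b hab p hp q hq
    refine mul_mem_of_mem_monSum (fun γ hγ c hc γ' hγ' d hd => ?_) hp hq
    have hle := E.o.add_le_add hγ hγ'
    obtain ⟨t, ht, htx⟩ := (ih _ hab).exists_mul_smon_mul_smon hle hc hd
    have h : t * smon E.x (γ.2 + γ'.2) ∈ E.tF (a + b) := by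
      refine mul_smon_mem_monSum (γ := γ + γ') ?_ ht
      rwa [wt_add]
    simpa using add_mem (tF_mono hle (lowerSum_le_tF _ htx)) h

/-- Multiplication of two terms: the product `(a x^{γ₂})(b x^{γ₂'})` agrees with a single term
`t x^{γ₂+γ₂'}` up to terms of smaller weight. -/
theorem exists_mul_smon_mul_smon {γ γ' : MIdx m × MIdx s} {a b : B} (ha : a ∈ E.F γ.1)
    (hb : b ∈ E.F γ'.1) :
    ∃ t ∈ E.F (γ.1 + γ'.1),
      a * smon E.x γ.2 * (b * smon E.x γ'.2) - t * smon E.x (γ.2 + γ'.2) ∈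
        E.lowerSum (E.wt γ + E.wt γ') :=
  (mulBelow _).exists_mul_smon_mul_smon (E.o.le_refl _) ha hb

theorem ltP_add_of_eq_or_ltP {p p' q q' : MIdx s × MIdx n} (h : p = p' ∨ E.ltP p p')
    (h' : E.ltP q q') : E.ltP (p + q) (p' + q') := by
  rcases h with rfl | h | ⟨h, h₂⟩ <;> rcases h' with h' | ⟨h', h₂'⟩
  · exact .inl (E.o.lt_add_left _ h')
  · exact .inr ⟨congrArg (p.2 + ·) h', E.o2.lt_add_left _ h₂'⟩
  · exact .inl (E.o.add_lt_add_of_lt_of_le h h'.1)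
  · exact .inl (E.o.add_lt_add_of_lt_of_le h (by rw [h']; exact E.o.le_refl _))
  · exact .inl (E.o.add_lt_add_of_le_of_lt (by rw [h]; exact E.o.le_refl _) h')
  · exact .inr ⟨congrArg₂ (· + ·) h h', E.o2.add_lt_add_of_lt_of_le h₂ h₂'.1⟩

theorem lowerSum_le_monSum_ltP {a b : MIdx n} (h : E.o.le a b) (α : MIdx s) :
    E.lowerSum a ≤ monSum K B E.F E.x fun ω => E.ltP (ω.2, E.wt ω) (α, b) :=
  monSum_mono fun _ hγ => .inl (E.o.lt_of_lt_of_le hγ h)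

theorem mul_mem_monSum_ltP {p q : MIdx s × MIdx n} {P Q : MIdx m × MIdx s → Prop}
    (h : ∀ γ γ', P γ → Q γ' →
      E.ltP ((γ.2, E.wt γ) + (γ'.2, E.wt γ')) (p + q)) {y z : B}
    (hy : y ∈ monSum K B E.F E.x P) (hz : z ∈ monSum K B E.F E.x Q) :
    y * z ∈ monSum K B E.F E.x fun ω => E.ltP (ω.2, E.wt ω) (p + q) := by
  refine mul_mem_of_mem_monSum (fun γ hγ a ha γ' hγ' b hb => ?_) hy hz
  obtain ⟨t, ht, htx⟩ := exists_mul_smon_mul_smon ha hb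
  have hlt := h γ γ' hγ hγ'
  have hle : E.o.le (E.wt γ + E.wt γ') (p + q).2 := by
    rcases hlt with hlt | ⟨hlt, -⟩
    · exact hlt.1
    · exact hlt ▸ E.o.le_refl _
  have htop : t * smon E.x (γ.2 + γ'.2) ∈
      monSum K B E.F E.x fun ω => E.ltP (ω.2, E.wt ω) (p + q) :=
    mul_smon_mem_monSum (γ := γ + γ') (by rw [wt_add]; exact hlt) ht
  have hsum := add_mem (lowerSum_le_monSum_ltP hle (p + q).1 htx) htop
  rwa [sub_add_cancel] at hsum

end BoundedExt

/-- **Lemma (conmutador).** Let `A ⊆ B` be a `(φ,ψ)`-bounded extension, let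
`(α₁,α₂), (β₁,β₂) ∈ ℕ^m × ℕ^s` and set `α = wt(α₁,α₂)`, `β = wt(β₁,β₂)`.  If
`r = r'·x^{α₂} + u` and `s = s'·x^{β₂} + v` with `r' ∈ F_{α₁}(A)`, `s' ∈ F_{β₁}(A)`,
`u ∈ Σ_{(μ₂,wt μ) ≺' (α₂,α)} F_{μ₁}(A)x^{μ₂}` and
`v ∈ Σ_{(ν₂,wt ν) ≺' (β₂,β)} F_{ν₁}(A)x^{ν₂}`, then there is `t ∈ F_{α₁+β₁}(A)` with
`r·s − t·x^{α₂+β₂} ∈ Σ_{(ω₂,wt ω) ≺' (α₂+β₂, α+β)} F_{ω₁}(A)x^{ω₂}`. -/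
theorem boundedExt_commutator_lemma {K : Type*} [CommRing K] {B : Type*} [Ring B]
    [Algebra K B] {m s n : ℕ} (E : BoundedExt K B m s n)
    (α₁ β₁ : MIdx m) (α₂ β₂ : MIdx s) (r' s' u v r sel : B)
    (hr' : r' ∈ E.F α₁) (hs' : s' ∈ E.F β₁)
    (hu : u ∈ monSum K B E.F E.x
      (fun μ => E.ltP (μ.2, E.wt μ) (α₂, E.wt (α₁, α₂))))
    (hv : v ∈ monSum K B E.F E.x
      (fun ν => E.ltP (ν.2, E.wt ν) (β₂, E.wt (β₁, β₂))))
    (hr : r = r' * smon E.x α₂ + u) (hs : sel = s' * smon E.x β₂ + v) :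
    ∃ t ∈ E.F (α₁ + β₁),
      r * sel - t * smon E.x (α₂ + β₂) ∈ monSum K B E.F E.x
        (fun ω => E.ltP (ω.2, E.wt ω) (α₂ + β₂, E.wt (α₁, α₂) + E.wt (β₁, β₂))) := by
  obtain ⟨t, ht, htx⟩ :=
    BoundedExt.exists_mul_smon_mul_smon (E := E) (γ := (α₁, α₂)) (γ' := (β₁, β₂)) hr' hs'
  refine ⟨t, ht, ?_⟩
  have hlead := BoundedExt.lowerSum_le_monSum_ltP (E.o.le_refl _) (α₂ + β₂) htx
  have hterm : r' * smon E.x α₂ ∈ monSum K B E.F E.x (· = (α₁, α₂)) := by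
    refine mul_smon_mem_monSum (γ := (α₁, α₂)) ?_ hr'
    exact rfl
  have hsel : sel ∈ monSum K B E.F E.x (fun ν => (ν.2, E.wt ν) = (β₂, E.wt (β₁, β₂)) ∨
      E.ltP (ν.2, E.wt ν) (β₂, E.wt (β₁, β₂))) := by
    rw [hs]
    refine add_mem (mul_smon_mem_monSum (γ := (β₁, β₂)) ?_ hs') (monSum_mono ?_ hv)
    · exact Or.inl rfl
    · exact fun _ h => Or.inr h
  have hrv := BoundedExt.mul_mem_monSum_ltP
    (p := (α₂, E.wt (α₁, α₂))) (q := (β₂, E.wt (β₁, β₂)))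
    (fun γ γ' hγ hγ' => BoundedExt.ltP_add_of_eq_or_ltP (.inl (by rw [hγ])) hγ') hterm hv
  have husel := BoundedExt.mul_mem_monSum_ltP
    (p := (α₂, E.wt (α₁, α₂))) (q := (β₂, E.wt (β₁, β₂)))
    (fun γ γ' hγ hγ' => by
      rw [add_comm, add_comm (α₂, _)]
      exact BoundedExt.ltP_add_of_eq_or_ltP hγ' hγ) hu hsel
  have hsum := add_mem (add_mem hlead hrv) husel
  have hexp : r * sel - t * smon E.x (α₂ + β₂) =
      r' * smon E.x α₂ * (s' * smon E.x β₂) - t * smon E.x (α₂ + β₂) +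
        r' * smon E.x α₂ * v + u * sel := by
    rw [hr, hs]
    noncomm_ring
  rw [hexp]
  exact hsum
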